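/- arXiv:2003.12985 — 3 statements merged into one kernel-verified Lean document; each statement's English description precedes it below -/
import Mathlib

section
/- For every n ≥ 2 and every K with 1 ≤ K < n, there exist N > 1 and a family of real matrices Y₁,…,Y_N with Yᵢ ∈ ℝ^{n×Mᵢ} that belongs to S_K^GS but not to S_K^SP; that is, each Yᵢ admits a factorization Yᵢ = Dᵢ Xᵢ with Dᵢ orthogonal and Xᵢ column-wise K-sparse, yet no single orthogonal matrix D works simultaneously for all groups. Consequently S_K^SP ⊊ S_K^GS for N > 1. -/
open Matrix Finset

/-- `D` is orthogonal (unitary real dictionary): `Dᵀ D = I`. -/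
def IsOrthogonal {n : ℕ} (D : Matrix (Fin n) (Fin n) ℝ) : Prop := Dᵀ * D = 1

/-- A vector is `K`-sparse if it has at most `K` nonzero entries. -/
def KSparseVec {n : ℕ} (K : ℕ) (x : Fin n → ℝ) : Prop :=
  (Finset.univ.filter (fun i => x i ≠ 0)).card ≤ K

/-- A matrix is column-wise `K`-sparse if every column has at most `K` nonzero entries. -/
def ColKSparse {n M : ℕ} (K : ℕ) (X : Matrix (Fin n) (Fin M) ℝ) : Prop :=
  ∀ j : Fin M, KSparseVec K (fun i => X i j)

/-- A matrix is jointly `K`-sparse if it has at most `K` nonzero rows. -/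
def JointKSparse {n M : ℕ} (K : ℕ) (X : Matrix (Fin n) (Fin M) ℝ) : Prop :=
  (@Finset.filter _ (fun i => X i ≠ 0)
    (fun i => @instDecidableNot _ (Fintype.decidablePiFintype (X i) 0)) Finset.univ).card ≤ K

/-- Every nonzero vector is a multiple of the `i₀`-th column of some orthogonal matrix. -/
lemma exists_orthogonal_col {n : ℕ} (i₀ : Fin n) (y : Fin n → ℝ) (hy : y ≠ 0) :
    ∃ D : Matrix (Fin n) (Fin n) ℝ, Dᵀ * D = 1 ∧ ∃ c : ℝ, ∀ k, y k = D k i₀ * c := by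
  set v : EuclideanSpace ℝ (Fin n) := WithLp.toLp 2 y with hv
  have hv0 : v ≠ 0 := by
    intro h
    apply hy
    funext k
    have := congrArg (fun w : EuclideanSpace ℝ (Fin n) => w k) h
    simpa [hv] using this
  have hn0 : ‖v‖ ≠ 0 := norm_ne_zero_iff.mpr hv0
  have hon : Orthonormal ℝ (({i₀} : Set (Fin n)).domRestrict
      (fun _ : Fin n => (‖v‖⁻¹ • v : EuclideanSpace ℝ (Fin n)))) := by
    constructor
    · intro i
      simp [Set.domRestrict, norm_smul, hn0]
    · intro i j hij
      exact absurd (Subsingleton.elim i j) hij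
  obtain ⟨b, hb⟩ := hon.exists_orthonormalBasis_extension_of_card_eq (by simp)
  refine ⟨Matrix.of fun k j => b j k, ?_, ‖v‖, ?_⟩
  · ext i j
    have := orthonormal_iff_ite.mp b.orthonormal i j
    rw [Matrix.mul_apply, Matrix.one_apply, ← this, PiLp.inner_apply]
    simp [Matrix.transpose_apply, mul_comm]
  · intro k
    rw [Matrix.of_apply, hb i₀ rfl]
    rw [PiLp.smul_apply, smul_eq_mul]
    have hk : v k = y k := rfl
    rw [hk]
    field_simp

/-- With `n * n + 1` points on the moment curve, not all are orthogonal to some member of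
a family of `n` nonzero vectors. -/
lemma moment_curve {n : ℕ} (d : Fin n → Fin n → ℝ) (hd : ∀ i, d i ≠ 0)
    (h : ∀ t : Fin (n * n + 1), ∃ i, ∑ k : Fin n, d i k * (t.val : ℝ) ^ k.val = 0) : False := by
  let p : Fin n → Polynomial ℝ := fun i => ∑ k : Fin n, Polynomial.monomial k.val (d i k)
  have hp : ∀ i, p i ≠ 0 := by
    intro i hi
    apply hd i
    funext k
    have := congrArg (fun q => Polynomial.coeff q k.val) hi
    simpa [p, Polynomial.coeff_monomial, Fin.val_inj] using this
  have hdeg : ∀ i, (p i).natDegree ≤ n := by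
    intro i
    apply Polynomial.natDegree_sum_le_of_forall_le
    intro k _
    exact (Polynomial.natDegree_monomial_le _).trans k.isLt.le
  have hP : ∏ i, p i ≠ 0 := Finset.prod_ne_zero_iff.mpr fun i _ => hp i
  have hPd : (∏ i, p i).natDegree ≤ n * n := by
    refine (Polynomial.natDegree_prod_le _ _).trans ?_
    refine (Finset.sum_le_sum fun i _ => hdeg i).trans ?_
    simp
  apply hP
  apply Polynomial.eq_zero_of_natDegree_lt_card_of_eval_eq_zero (∏ i, p i)
    (f := fun t : Fin (n * n + 1) => (t.val : ℝ))
  · intro a b hab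
    have hab2 : (a.val : ℝ) = (b.val : ℝ) := hab
    exact Fin.ext (by exact_mod_cast hab2)
  · intro t
    obtain ⟨i, hi⟩ := h t
    rw [Polynomial.eval_prod]
    apply Finset.prod_eq_zero (Finset.mem_univ i)
    simpa [p, Polynomial.eval_finsetSum, Polynomial.eval_monomial] using hi
  · simp
    omega

/-- strictness of Theorem 2(1) / Lemma 5: for every `n ≥ 2` and
`1 ≤ K < n`, there is a family (with `N > 1` groups) in `S_K^GS` but not in `S_K^SP`;
hence `S_K^SP ⊊ S_K^GS` when `N > 1`. -/
theorem GS_strictly_larger_than_SP (n K : ℕ) (hn : 2 ≤ n) (hK1 : 1 ≤ K) (hKn : K < n) :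
    ∃ N : ℕ, 1 < N ∧
      ∃ (M : Fin N → ℕ) (Y : (i : Fin N) → Matrix (Fin n) (Fin (M i)) ℝ),
        (∃ D : Fin N → Matrix (Fin n) (Fin n) ℝ,
          ∃ X : (i : Fin N) → Matrix (Fin n) (Fin (M i)) ℝ,
            ∀ i, IsOrthogonal (D i) ∧ ColKSparse K (X i) ∧ Y i = D i * X i) ∧
        ¬ (∃ D : Matrix (Fin n) (Fin n) ℝ, IsOrthogonal D ∧
            ∃ X : (i : Fin N) → Matrix (Fin n) (Fin (M i)) ℝ,
              ∀ i, ColKSparse K (X i) ∧ Y i = D * X i) := by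
  let y : Fin (n * n + 1) → Fin n → ℝ := fun t k => (t.val : ℝ) ^ k.val
  have i₀ : Fin n := ⟨0, by omega⟩
  have hy : ∀ t, y t ≠ 0 := by
    intro t h
    have := congrFun h ⟨0, by omega⟩
    simp [y] at this
  refine ⟨n * n + 1, by nlinarith, fun _ => 1, fun t => Matrix.of fun k _ => y t k, ?_, ?_⟩
  · choose D hD c hc using fun t => exists_orthogonal_col i₀ (y t) (hy t)
    refine ⟨D, fun t => Matrix.of fun k _ => if k = i₀ then c t else 0, fun t => ⟨hD t, ?_, ?_⟩⟩
    · intro j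
      unfold KSparseVec
      refine le_trans (Finset.card_le_card (t := {i₀}) ?_) (by simpa using hK1)
      intro k hk
      by_contra hne
      simp at hk hne
      exact hne hk.1
    · ext k j
      rw [Matrix.mul_apply]
      simp [hc t k]
  · rintro ⟨D, hD, X, hX⟩
    unfold IsOrthogonal at hD
    apply moment_curve (fun i k => D k i)
    · intro i hi
      have h1 := congrFun (congrFun hD i) i
      rw [Matrix.mul_apply] at h1
      have h2 : ∀ k, D k i = 0 := fun k => congrFun hi k
      simp [h2] at h1
    · intro t
      obtain ⟨hs, hYX⟩ := hX t
      have hs0 := hs 0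
      unfold KSparseVec at hs0
      have : ∃ i, X t i 0 = 0 := by
        by_contra hcon
        push Not at hcon
        rw [Finset.filter_true_of_mem (fun i _ => hcon i)] at hs0
        simp at hs0
        omega
      obtain ⟨i, hi⟩ := this
      refine ⟨i, ?_⟩
      have h3 : X t = Dᵀ * (Matrix.of fun k _ => y t k : Matrix (Fin n) (Fin 1) ℝ) := by
        have hY2 : (Matrix.of fun k _ => y t k : Matrix (Fin n) (Fin 1) ℝ) = D * X t := hYX
        rw [hY2, ← Matrix.mul_assoc, hD, Matrix.one_mul]
      rw [h3, Matrix.mul_apply] at hi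
      simpa [y, Matrix.transpose_apply] using hi
end

section
/- Let 1 ≤ K < n and let N > C(n,K) (the binomial coefficient). Then there exists a family of real matrices Y₁,…,Y_N with Yᵢ ∈ ℝ^{n×K} such that rank(Yᵢ) ≤ K for all i (so the family is in S_K^LR), yet there exist no orthogonal D ∈ ℝ^{n×n} and column-wise K-sparse matrices Xᵢ with Yᵢ = D Xᵢ for all i (so the family is not in S_K^SP). Hence S_K^LR ⊄ S_K^SP when N > C(n,K). -/
open Matrix Finset

/-- Lemma 7 / Theorem 2(5): for `1 ≤ K < n` and `N > C(n,K)`, there is a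
family of `n × K` matrices in `S_K^LR` but not in `S_K^SP`; hence `S_K^LR ⊄ S_K^SP`. -/
theorem LR_not_subset_SP (n K N : ℕ) (hK1 : 1 ≤ K) (hKn : K < n)
    (hN : Nat.choose n K < N) :
    ∃ Y : Fin N → Matrix (Fin n) (Fin K) ℝ,
      (∀ i, (Y i).rank ≤ K) ∧
      ¬ (∃ D : Matrix (Fin n) (Fin n) ℝ, IsOrthogonal D ∧
          ∃ X : Fin N → Matrix (Fin n) (Fin K) ℝ,
            ∀ i, ColKSparse K (X i) ∧ Y i = D * X i) := by
  refine ⟨fun i => Matrix.of fun r j => ((finProdFinEquiv (i, j) : ℕ) : ℝ) ^ (r : ℕ), ?_, ?_⟩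
  · intro i
    exact (Matrix.rank_le_width _)
  rintro ⟨D, -, X, hX⟩
  have hsup : ∀ p : Fin N × Fin K, ∃ T ∈ Finset.powersetCard K (Finset.univ : Finset (Fin n)),
      ∀ s, s ∉ T → X p.1 s p.2 = 0 := by
    intro p
    have h := (hX p.1).1 p.2
    unfold KSparseVec at h
    obtain ⟨T, hT1, hT2⟩ := Finset.exists_superset_card_eq h (by simpa using hKn.le)
    refine ⟨T, by simp [Finset.mem_powersetCard, hT2], fun s hs => ?_⟩
    by_contra hne
    exact hs (hT1 (by simpa using hne))
  choose T hT hT0 using hsup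
  obtain ⟨S, hS, hlt⟩ := Finset.exists_lt_card_fiber_of_mul_lt_card_of_maps_to
    (s := (Finset.univ : Finset (Fin N × Fin K)))
    (t := Finset.powersetCard K (Finset.univ : Finset (Fin n))) (f := T) (n := K)
    (fun p _ => hT p) (by
      simp only [Finset.card_powersetCard, Finset.card_univ, Fintype.card_fin, Fintype.card_prod]
      exact Nat.mul_lt_mul_of_pos_right hN hK1)
  obtain ⟨F, hF, hFc⟩ := Finset.exists_subset_card_eq (Nat.succ_le_of_lt hlt)
  let e := F.equivFinOfCardEq hFc
  let q : Fin (K + 1) → Fin N × Fin K := fun a => (e.symm a).1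
  have hq : Function.Injective q := Subtype.val_injective.comp e.symm.injective
  have hqT : ∀ a, T (q a) = S := fun a => (Finset.mem_filter.1 (hF (e.symm a).2)).2
  have hSc : S.card = K := (Finset.mem_powersetCard.1 hS).2
  let M : Matrix S (Fin (K + 1)) ℝ := Matrix.of fun s a => X (q a).1 s (q a).2
  have hker : LinearMap.ker M.mulVecLin ≠ ⊥ :=
    LinearMap.ker_ne_bot_of_finrank_lt (by simp [hSc])
  obtain ⟨c, hc, hc0⟩ := (Submodule.ne_bot_iff _).1 hker
  have hx : ∀ s, ∑ a, X (q a).1 s (q a).2 * c a = 0 := by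
    intro s
    by_cases hs : s ∈ S
    · have := congrFun (LinearMap.mem_ker.1 hc) ⟨s, hs⟩
      simpa [M, Matrix.mulVec, dotProduct] using this
    · refine Finset.sum_eq_zero fun a _ => ?_
      rw [hT0 (q a) s (by rwa [hqT a]), zero_mul]
  have hy : ∀ r : Fin n, ∑ a, c a * ((finProdFinEquiv (q a) : ℕ) : ℝ) ^ (r : ℕ) = 0 := by
    intro r
    have h1 : ∀ a, ((finProdFinEquiv (q a) : ℕ) : ℝ) ^ (r : ℕ)
        = ∑ s, D r s * X (q a).1 s (q a).2 := by
      intro a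
      have := congrFun (congrFun (hX (q a).1).2 r) (q a).2
      rw [Matrix.mul_apply] at this
      exact this
    simp_rw [h1, Finset.mul_sum]
    rw [Finset.sum_comm]
    refine Finset.sum_eq_zero fun s _ => ?_
    have := hx s
    calc _ = D r s * ∑ a, X (q a).1 s (q a).2 * c a := by
            rw [Finset.mul_sum]
            exact Finset.sum_congr rfl fun a _ => by ring
      _ = 0 := by rw [this, mul_zero]
  apply hc0
  refine Matrix.eq_zero_of_forall_pow_sum_mul_pow_eq_zero
    (f := fun a => ((finProdFinEquiv (q a) : ℕ) : ℝ)) ?_ ?_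
  · intro a b hab
    exact hq (finProdFinEquiv.injective (Fin.ext (Nat.cast_injective hab)))
  · intro i
    exact hy ⟨i, by omega⟩
end

section
/- For every K ≥ 2 there exists a matrix X ∈ ℝ^{(K+1)×(K+1)} such that: (i) every column of X has at most K nonzero entries; (ii) rank(X) = K; and (iii) X has exactly K+1 nonzero rows (so X is not jointly K-sparse). -/
open Matrix Finset

/-- counterexample construction in Lemma 8: for every `K ≥ 2` there is a
`(K+1) × (K+1)` matrix that is column-wise `K`-sparse, of rank exactly `K`, and with all
`K+1` rows nonzero (hence not jointly `K`-sparse). -/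
theorem exists_colSparse_lowRank_not_jointSparse (K : ℕ) (hK : 2 ≤ K) :
    ∃ X : Matrix (Fin (K + 1)) (Fin (K + 1)) ℝ,
      ColKSparse K X ∧ X.rank = K ∧
      (@Finset.filter _ (fun i => X i ≠ 0)
        (fun i => @instDecidableNot _ (Fintype.decidablePiFintype (X i) 0)) Finset.univ).card = K + 1 := by
  have hne : (0 : Fin (K + 1)) ≠ Fin.last K := by
    intro h
    have := congrArg Fin.val h
    simp at this
    omega
  refine ⟨Matrix.of fun i => Pi.single (if i = Fin.last K then 0 else i) (1 : ℝ), ?_, ?_, ?_⟩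
  · intro j
    unfold KSparseVec
    refine le_trans (Finset.card_le_card (t := {j, Fin.last K}) ?_) (le_trans Finset.card_le_two hK)
    intro i hi
    by_cases h : i = Fin.last K
    · simp [h]
    · have h2 : i = j := by
        by_contra hij
        have hji : j ≠ i := fun e => hij e.symm
        simp [h, Pi.single_apply, hji] at hi
      simp [h2]
  · rw [Matrix.rank_eq_finrank_span_row]
    have hr : Set.range (Matrix.of fun i : Fin (K + 1) =>
        (Pi.single (if i = Fin.last K then 0 else i) (1 : ℝ) : Fin (K + 1) → ℝ)).row
        = Set.range (fun i : Fin K => (Pi.single i.castSucc (1 : ℝ) : Fin (K + 1) → ℝ)) := by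
      ext v
      constructor
      · rintro ⟨i, rfl⟩
        have hi : (if i = Fin.last K then 0 else i) ≠ Fin.last K := by
          split_ifs with h
          · exact hne
          · exact h
        obtain ⟨k, hk⟩ := Fin.exists_castSucc_eq.mpr hi
        refine ⟨k, ?_⟩
        simp only [hk]
        rfl
      · rintro ⟨k, rfl⟩
        refine ⟨k.castSucc, ?_⟩
        have : k.castSucc ≠ Fin.last K := Fin.castSucc_ne_last k
        change (Pi.single (if k.castSucc = Fin.last K then 0 else k.castSucc) (1 : ℝ) :
          Fin (K + 1) → ℝ) = _
        rw [if_neg this]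
    rw [hr, finrank_span_eq_card, Fintype.card_fin]
    exact (Pi.linearIndependent_single_one (Fin (K + 1)) ℝ).comp _ (Fin.castSucc_injective K)
  · refine (congrArg Finset.card (Finset.eq_univ_of_forall fun i => ?_)).trans
      (Finset.card_fin (K + 1))
    refine (@Finset.mem_filter _ _ (_) _ _).mpr ⟨Finset.mem_univ i, fun h => ?_⟩
    have := congrFun h (if i = Fin.last K then 0 else i)
    simp at this
end
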